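/- (Completeness of loop formulas) Let P be a FASP program, let L(P) be the set of all loops of P, and let LF(P) = { LF(L,P) | L ∈ L(P) } be the set of all loop formulas of P. Then every answer set I of P is a model of LF(P) ∪ comp(P); in particular, for every loop L of P, max { I(l) | l ∈ L } ≤ max { I(body(r)) | r ∈ R⁻(P,L) } (where max ∅ = 0). -/

import Mathlib

/-- A t-norm on `[0,1]`: an increasing (in each argument), commutative and associative
binary operator on `[0,1]` with neutral element `1`. -/
structure Tnorm where
  T : ℝ → ℝ → ℝ
  mem_Icc : ∀ x ∈ Set.Icc (0:ℝ) 1, ∀ y ∈ Set.Icc (0:ℝ) 1, T x y ∈ Set.Icc (0:ℝ) 1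
  mono : ∀ x ∈ Set.Icc (0:ℝ) 1, ∀ x' ∈ Set.Icc (0:ℝ) 1, ∀ y ∈ Set.Icc (0:ℝ) 1,
    ∀ y' ∈ Set.Icc (0:ℝ) 1, x ≤ x' → y ≤ y' → T x y ≤ T x' y'
  comm : ∀ x ∈ Set.Icc (0:ℝ) 1, ∀ y ∈ Set.Icc (0:ℝ) 1, T x y = T y x
  assoc : ∀ x ∈ Set.Icc (0:ℝ) 1, ∀ y ∈ Set.Icc (0:ℝ) 1, ∀ z ∈ Set.Icc (0:ℝ) 1,
    T (T x y) z = T x (T y z)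
  one_T : ∀ x ∈ Set.Icc (0:ℝ) 1, T 1 x = x

/-- Left continuity of a t-norm in each argument (on `[0,1]`). -/
def Tnorm.LeftContinuous (Tn : Tnorm) : Prop :=
  ∀ x ∈ Set.Icc (0:ℝ) 1, ∀ y ∈ Set.Icc (0:ℝ) 1,
    ContinuousWithinAt (fun t => Tn.T x t) (Set.Icc (0:ℝ) y) y ∧
    ContinuousWithinAt (fun t => Tn.T t y) (Set.Icc (0:ℝ) x) x

/-- The residual implicator of a t-norm: `I_T(x,y) = sup { λ ∈ [0,1] | T(x,λ) ≤ y }`. -/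
noncomputable def Tnorm.resid (Tn : Tnorm) (x y : ℝ) : ℝ :=
  sSup { l | l ∈ Set.Icc (0:ℝ) 1 ∧ Tn.T x l ≤ y }

/-- The n-ary extension of a t-norm: `T(b) = b`, `T(b₁,…,bₙ) = T(b₁, T(b₂,…,bₙ))`. -/
def Tnorm.listEval (Tn : Tnorm) : List ℝ → ℝ
  | [] => 1
  | [x] => x
  | x :: xs => Tn.T x (Tn.listEval xs)

/-- A negator: a decreasing `[0,1] → [0,1]` map with `N(0) = 1` and `N(1) = 0`. -/
structure Negator where
  N : ℝ → ℝ
  mem_Icc : ∀ x ∈ Set.Icc (0:ℝ) 1, N x ∈ Set.Icc (0:ℝ) 1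
  anti : ∀ x ∈ Set.Icc (0:ℝ) 1, ∀ y ∈ Set.Icc (0:ℝ) 1, x ≤ y → N y ≤ N x
  N_zero : N 0 = 1
  N_one : N 1 = 0

/-- A body element of a FASP rule: an atom, a constant from `[0,1]`, or a negated atom. -/
inductive Lit (α : Type*) where
  | pos : α → Lit α
  | const : ℝ → Lit α
  | neg : Negator → α → Lit α

/-- A FASP rule `a ← T(b₁,…,bₙ)`: a head (an atom or a constant in `[0,1]`), a body
(a list of extended literals, combined by the rule's t-norm). -/
structure Rule (α : Type*) where
  head : α ⊕ ℝ
  body : List (Lit α)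
  tnorm : Tnorm

/-- Well-formedness of a literal: constants must lie in `[0,1]`. -/
def Lit.WF {α : Type*} : Lit α → Prop
  | .const c => c ∈ Set.Icc (0:ℝ) 1
  | _ => True

/-- Well-formedness of a rule: nonempty body, constants in `[0,1]`, and a
left-continuous t-norm. -/
def Rule.WF {α : Type*} (r : Rule α) : Prop :=
  r.body ≠ [] ∧ (∀ l ∈ r.body, l.WF) ∧ r.tnorm.LeftContinuous ∧
    ∀ c : ℝ, r.head = Sum.inr c → c ∈ Set.Icc (0:ℝ) 1

/-- Well-formedness of a FASP program (a set of rules). -/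
def ProgramWF {α : Type*} (P : Set (Rule α)) : Prop := ∀ r ∈ P, r.WF

/-- An interpretation maps every atom to a value in `[0,1]`. -/
def IsInterp {α : Type*} (I : α → ℝ) : Prop := ∀ a, I a ∈ Set.Icc (0:ℝ) 1

/-- Evaluation of an extended literal: `I(c) = c`, `I(N(b)) = N(I(b))`. -/
def Lit.eval {α : Type*} (I : α → ℝ) : Lit α → ℝ
  | .pos a => I a
  | .const c => c
  | .neg n a => n.N (I a)

/-- Evaluation of a rule body: `I(body(r)) = T_r(I(b₁),…,I(bₙ))`. -/
def Rule.evalBody {α : Type*} (I : α → ℝ) (r : Rule α) : ℝ :=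
  r.tnorm.listEval (r.body.map (Lit.eval I))

/-- Evaluation of a rule head. -/
def evalHead {α : Type*} (I : α → ℝ) : α ⊕ ℝ → ℝ
  | .inl a => I a
  | .inr c => c

/-- The atoms occurring positively (non-negated) in the body of a rule. -/
def Rule.posbody {α : Type*} (r : Rule α) : Set α := { a | Lit.pos a ∈ r.body }

/-- The immediate consequence operator:
`Π_P(I)(a) = sup { I(body(r)) | r ∈ P_a }` (with `sup ∅ = 0`). -/
noncomputable def PiOp {α : Type*} (P : Set (Rule α)) (I : α → ℝ) : α → ℝ :=
  fun a => sSup { x | ∃ r ∈ P, r.head = Sum.inl a ∧ x = r.evalBody I }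

/-- `I` is a model of `P` iff `I(r) = I_r(I(body(r)), I(head(r))) = 1` for all `r ∈ P`. -/
def IsModel {α : Type*} (P : Set (Rule α)) (I : α → ℝ) : Prop :=
  ∀ r ∈ P, r.tnorm.resid (r.evalBody I) (evalHead I r.head) = 1

/-- The support of an interpretation: `supp(I) = { a | I(a) > 0 }`. -/
def supp {α : Type*} (I : α → ℝ) : Set α := { a | 0 < I a }

/-- `U` is unfounded w.r.t. `I`: for each `u ∈ U` and rule `r ∈ P_u`, either
`U ∩ posbody(r) ≠ ∅`, or `I(u) > I(body(r))`, or `I(body(r)) = 0`. -/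
def Unfounded {α : Type*} (P : Set (Rule α)) (I : α → ℝ) (U : Set α) : Prop :=
  ∀ u ∈ U, ∀ r ∈ P, r.head = Sum.inl u →
    (U ∩ r.posbody).Nonempty ∨ r.evalBody I < I u ∨ r.evalBody I = 0

/-- `I` is unfounded-free iff `supp(I) ∩ U = ∅` for every unfounded set `U`. -/
def UnfoundedFree {α : Type*} (P : Set (Rule α)) (I : α → ℝ) : Prop :=
  ∀ U : Set α, Unfounded P I U → supp I ∩ U = ∅

/-- An answer set of `P` is an unfounded-free model of `P`. -/
def IsAnswerSet {α : Type*} (P : Set (Rule α)) (I : α → ℝ) : Prop :=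
  IsModel P I ∧ UnfoundedFree P I

/-- The reduct of a literal w.r.t. `I`: every negated atom `N(b)` is replaced by the
constant `N(I(b))`. -/
def Lit.reduct {α : Type*} (I : α → ℝ) : Lit α → Lit α
  | .neg n a => .const (n.N (I a))
  | l => l

/-- The reduct of a rule w.r.t. `I`. -/
def Rule.reduct {α : Type*} (I : α → ℝ) (r : Rule α) : Rule α :=
  ⟨r.head, r.body.map (Lit.reduct I), r.tnorm⟩

/-- The reduct of a program: `P^I = { r^I | r ∈ P }`. -/
def reduct {α : Type*} (P : Set (Rule α)) (I : α → ℝ) : Set (Rule α) :=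
  (Rule.reduct I) '' P

/-- `F` is the least fixpoint of `Π_P` (among interpretations). -/
def IsLfp {α : Type*} (P : Set (Rule α)) (F : α → ℝ) : Prop :=
  IsInterp F ∧ PiOp P F = F ∧
    ∀ G : α → ℝ, IsInterp G → PiOp P G = G → ∀ a, F a ≤ G a

/-- `I` is a model of the completion `comp(P)`: for every atom `a`,
`I(a) = sup { I(body(r)) | r ∈ P_a }` (with `sup ∅ = 0`), and for every rule with a
constant head `c`, `I(body(r)) ≤ c`. -/
def ModelsComp {α : Type*} (P : Set (Rule α)) (I : α → ℝ) : Prop :=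
  (∀ a, I a = sSup { x | ∃ r ∈ P, r.head = Sum.inl a ∧ x = r.evalBody I }) ∧
  (∀ r ∈ P, ∀ c : ℝ, r.head = Sum.inr c → r.evalBody I ≤ c)

/-- Edge of the positive dependency graph of `P`: `(a,b)` iff some rule with head `a`
has `b` occurring positively in its body. -/
def depEdge {α : Type*} (P : Set (Rule α)) (a b : α) : Prop :=
  ∃ r ∈ P, r.head = Sum.inl a ∧ b ∈ r.posbody

/-- A loop of `P`: a nonempty set `L` of atoms such that any two elements of `L` are
joined by a path of positive length in the positive dependency graph all of whose
vertices lie in `L`. -/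
def IsLoop {α : Type*} (P : Set (Rule α)) (L : Set α) : Prop :=
  L.Nonempty ∧ ∀ a ∈ L, ∀ b ∈ L,
    Relation.TransGen (fun u v => depEdge P u v ∧ u ∈ L ∧ v ∈ L) a b

/-- `R⁻(P,L)`: the rules of `P` with head in `L` whose positive body is disjoint
from `L`. -/
def extRules {α : Type*} (P : Set (Rule α)) (L : Set α) : Set (Rule α) :=
  { r | r ∈ P ∧ (∃ a ∈ L, r.head = Sum.inl a) ∧ r.posbody ∩ L = ∅ }

/-- `I` satisfies the loop formula `LF(L,P)` iff
`max { I(l) | l ∈ L } ≤ max { I(body(r)) | r ∈ R⁻(P,L) }` (right-hand side `0` when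
`R⁻(P,L) = ∅`). -/
def SatLF {α : Type*} (P : Set (Rule α)) (L : Set α) (I : α → ℝ) : Prop :=
  sSup (I '' L) ≤ sSup { x | ∃ r ∈ extRules P L, x = r.evalBody I }

/-- A simple program: no rule body contains a negated atom. -/
def Simple {α : Type*} (P : Set (Rule α)) : Prop :=
  ∀ r ∈ P, ∀ l ∈ r.body, ∀ (n : Negator) (a : α), l ≠ Lit.neg n a

namespace Tnorm

variable (Tn : Tnorm)

theorem T_one {x : ℝ} (hx : x ∈ Set.Icc (0:ℝ) 1) : Tn.T x 1 = x := by
  rw [Tn.comm x hx 1 (by simp), Tn.one_T x hx]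

theorem T_le_left {x y : ℝ} (hx : x ∈ Set.Icc (0:ℝ) 1) (hy : y ∈ Set.Icc (0:ℝ) 1) :
    Tn.T x y ≤ x :=
  (Tn.mono x hx x hx y hy 1 (by simp) le_rfl hy.2).trans_eq (Tn.T_one hx)

theorem T_le_right {x y : ℝ} (hx : x ∈ Set.Icc (0:ℝ) 1) (hy : y ∈ Set.Icc (0:ℝ) 1) :
    Tn.T x y ≤ y :=
  (Tn.mono x hx 1 (by simp) y hy y hy hx.2 le_rfl).trans_eq (Tn.one_T y hy)

theorem listEval_mem_Icc : ∀ l : List ℝ, (∀ x ∈ l, x ∈ Set.Icc (0:ℝ) 1) →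
    Tn.listEval l ∈ Set.Icc (0:ℝ) 1
  | [], _ => by simp [listEval]
  | [x], h => h x (by simp)
  | x :: y :: l, h =>
    Tn.mem_Icc x (h x (by simp)) _
      (listEval_mem_Icc (y :: l) fun z hz => h z (List.mem_cons_of_mem x hz))

theorem listEval_le_of_mem : ∀ l : List ℝ, (∀ x ∈ l, x ∈ Set.Icc (0:ℝ) 1) →
    ∀ x ∈ l, Tn.listEval l ≤ x
  | [], _ => by simp
  | [x], _ => by simp [listEval]
  | x :: y :: l, h => by
    have htail : ∀ z ∈ y :: l, z ∈ Set.Icc (0:ℝ) 1 :=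
      fun z hz => h z (List.mem_cons_of_mem x hz)
    have hx := h x (by simp)
    have hmem := Tn.listEval_mem_Icc (y :: l) htail
    intro z hz
    rcases List.mem_cons.1 hz with rfl | hz
    · exact Tn.T_le_left hx hmem
    · exact (Tn.T_le_right hx hmem).trans (listEval_le_of_mem (y :: l) htail z hz)

theorem le_of_resid_eq_one {Tn : Tnorm} (hT : Tn.LeftContinuous) {x y : ℝ}
    (hx : x ∈ Set.Icc (0:ℝ) 1) (h : Tn.resid x y = 1) : x ≤ y := by
  have hlt : ∀ t ∈ Set.Ico (0:ℝ) 1, Tn.T x t ≤ y := by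
    intro t ht
    have hne : { l | l ∈ Set.Icc (0:ℝ) 1 ∧ Tn.T x l ≤ y }.Nonempty := by
      by_contra hne
      rw [Set.not_nonempty_iff_eq_empty] at hne
      rw [resid, hne, Real.sSup_empty] at h
      exact zero_ne_one h
    obtain ⟨l, ⟨hl, hly⟩, htl⟩ := exists_lt_of_lt_csSup hne (ht.2.trans_eq h.symm)
    exact (Tn.mono x hx x hx t ⟨ht.1, ht.2.le⟩ l hl le_rfl htl.le).trans hly
  have hcont := ((hT x hx 1 (by simp)).1).mono Set.Ico_subset_Icc_self
  have hcl : (1:ℝ) ∈ closure (Set.Ico (0:ℝ) 1) := by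
    rw [closure_Ico (by norm_num)]; simp
  rw [← Tn.T_one hx]
  have := mem_closure_iff_nhdsWithin_neBot.1 hcl
  exact le_of_tendsto hcont (eventually_nhdsWithin_of_forall hlt)

end Tnorm

section Evaluation

variable {α : Type*} {I : α → ℝ} {P : Set (Rule α)}

theorem Lit.eval_mem_Icc (hI : IsInterp I) : ∀ l : Lit α, l.WF → l.eval I ∈ Set.Icc (0:ℝ) 1
  | .pos a, _ => hI a
  | .const _, h => h
  | .neg n a, _ => n.mem_Icc _ (hI a)

theorem Rule.forall_map_eval_mem_Icc (hI : IsInterp I) {r : Rule α} (hr : r.WF) :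
    ∀ x ∈ r.body.map (Lit.eval I), x ∈ Set.Icc (0:ℝ) 1 := by
  intro x hx
  obtain ⟨l, hl, rfl⟩ := List.mem_map.1 hx
  exact l.eval_mem_Icc hI (hr.2.1 l hl)

theorem Rule.evalBody_mem_Icc (hI : IsInterp I) {r : Rule α} (hr : r.WF) :
    r.evalBody I ∈ Set.Icc (0:ℝ) 1 :=
  r.tnorm.listEval_mem_Icc _ (r.forall_map_eval_mem_Icc hI hr)

theorem Rule.evalBody_le_of_mem_posbody (hI : IsInterp I) {r : Rule α} (hr : r.WF) {a : α}
    (ha : a ∈ r.posbody) : r.evalBody I ≤ I a :=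
  r.tnorm.listEval_le_of_mem _ (r.forall_map_eval_mem_Icc hI hr) _
    (List.mem_map.2 ⟨_, ha, rfl⟩)

theorem IsModel.evalBody_le_evalHead (hwf : ProgramWF P) (hI : IsInterp I) (hM : IsModel P I)
    {r : Rule α} (hr : r ∈ P) : r.evalBody I ≤ evalHead I r.head :=
  Tnorm.le_of_resid_eq_one (hwf r hr).2.2.1 (Rule.evalBody_mem_Icc hI (hwf r hr)) (hM r hr)

theorem UnfoundedFree.le_zero (h : UnfoundedFree P I) {U : Set α} (hU : Unfounded P I U)
    {u : α} (hu : u ∈ U) : I u ≤ 0 := by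
  by_contra! hpos
  exact Set.eq_empty_iff_forall_notMem.1 (h U hU) u ⟨hpos, hu⟩

theorem IsAnswerSet.modelsComp (hwf : ProgramWF P) (hI : IsInterp I) (h : IsAnswerSet P I) :
    ModelsComp P I := by
  have hle : ∀ a, ∀ r ∈ P, r.head = Sum.inl a → r.evalBody I ≤ I a := by
    intro a r hr ha
    simpa [ha, evalHead] using h.1.evalBody_le_evalHead hwf hI hr
  refine ⟨fun a => le_antisymm ?_ ?_, fun r hr c hc => ?_⟩
  · by_contra! hlt
    have hU : Unfounded P I {a} := by
      rintro u rfl r hr hu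
      have hbdd : BddAbove { x | ∃ r ∈ P, r.head = Sum.inl u ∧ x = r.evalBody I } := by
        refine ⟨I u, ?_⟩
        rintro _ ⟨r', hr', hu', rfl⟩
        exact hle u r' hr' hu'
      exact .inr (.inl ((le_csSup hbdd ⟨r, hr, hu, rfl⟩).trans_lt hlt))
    have hsup : 0 ≤ sSup { x | ∃ r ∈ P, r.head = Sum.inl a ∧ x = r.evalBody I } := by
      refine Real.sSup_nonneg ?_
      rintro _ ⟨r, hr, -, rfl⟩
      exact (Rule.evalBody_mem_Icc hI (hwf r hr)).1
    exact (hsup.trans_lt hlt).not_ge (h.2.le_zero hU rfl)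
  · refine Real.sSup_le ?_ (hI a).1
    rintro _ ⟨r, hr, ha, rfl⟩
    exact hle a r hr ha
  · simpa [hc, evalHead] using h.1.evalBody_le_evalHead hwf hI hr

/-- Loop formulas hold for arbitrary sets of atoms: the atoms of `L` whose value exceeds every
external body form an unfounded set. -/
theorem IsAnswerSet.satLF (hwf : ProgramWF P) (hI : IsInterp I) (h : IsAnswerSet P I)
    (L : Set α) : SatLF P L I := by
  have hpos : 0 ≤ sSup { x | ∃ r ∈ extRules P L, x = r.evalBody I } := by
    refine Real.sSup_nonneg ?_
    rintro _ ⟨r, hr, rfl⟩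
    exact (Rule.evalBody_mem_Icc hI (hwf r hr.1)).1
  have hbdd : BddAbove { x | ∃ r ∈ extRules P L, x = r.evalBody I } := by
    refine ⟨1, ?_⟩
    rintro _ ⟨r, hr, rfl⟩
    exact (Rule.evalBody_mem_Icc hI (hwf r hr.1)).2
  unfold SatLF
  set M := sSup { x | ∃ r ∈ extRules P L, x = r.evalBody I }
  have hU : Unfounded P I {u ∈ L | M < I u} := by
    rintro u ⟨huL, hMu⟩ r hr hu
    rcases (r.posbody ∩ L).eq_empty_or_nonempty with hdisj | ⟨v, hv, hvL⟩
    · exact .inr (.inl ((le_csSup hbdd ⟨r, ⟨hr, ⟨u, huL, hu⟩, hdisj⟩, rfl⟩).trans_lt hMu))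
    · rcases lt_or_ge M (I v) with hMv | hvM
      · exact .inl ⟨v, ⟨hvL, hMv⟩, hv⟩
      · exact .inr (.inl (((Rule.evalBody_le_of_mem_posbody hI (hwf r hr) hv).trans
          hvM).trans_lt hMu))
  refine Real.sSup_le ?_ hpos
  rintro _ ⟨u, huL, rfl⟩
  by_contra! hMu
  exact (hpos.trans_lt hMu).not_ge (h.2.le_zero hU ⟨huL, hMu⟩)

end Evaluation

/-- Completeness of loop formulas: every answer set `I` of `P` is a
model of `LF(P) ∪ comp(P)`; in particular, for every loop `L` of `P`,
`max { I(l) | l ∈ L } ≤ max { I(body(r)) | r ∈ R⁻(P,L) }` (with `max ∅ = 0`). -/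
theorem answerSet_models_comp_and_loopFormulas {α : Type*} [Finite α]
    (P : Set (Rule α)) (hfin : P.Finite) (hwf : ProgramWF P)
    (I : α → ℝ) (hI : IsInterp I) (hAS : IsAnswerSet P I) :
    ModelsComp P I ∧ ∀ L : Set α, IsLoop P L → SatLF P L I :=
  ⟨hAS.modelsComp hwf hI, fun L _ => hAS.satLF hwf hI L⟩
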